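/- If X and X' are independent identically distributed real random variables whose common law has a log-concave density, then X − X' has a log-concave density. -/

import Mathlib

open MeasureTheory ProbabilityTheory

/-- `f` is log-concave: `f (λx + (1-λ)y) ≥ f x ^ λ * f y ^ (1-λ)`. -/
def IsLogConcave (f : ℝ → ℝ) : Prop :=
  ∀ x y l : ℝ, 0 ≤ l → l ≤ 1 →
    Real.rpow (f x) l * Real.rpow (f y) (1 - l) ≤ f (l * x + (1 - l) * y)

open Set
open scoped ENNReal Pointwise

theorem IsCompact.volume_add_volume_le_volume_add {K L : Set ℝ} (hK : IsCompact K)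
    (hL : IsCompact L) (hK0 : K.Nonempty) (hL0 : L.Nonempty) :
    volume K + volume L ≤ volume (K + L) := by
  have hdisj : AEDisjoint volume (sInf L +ᵥ K) (sSup K +ᵥ L) := by
    refine measure_mono_null (t := {sSup K + sInf L}) ?_ (by simp)
    rintro _ ⟨⟨x, hx, rfl⟩, y, hy, hxy⟩
    have hx' := le_csSup hK.bddAbove hx
    have hy' := csInf_le hL.bddBelow hy
    simp only [vadd_eq_add, mem_singleton_iff] at hxy ⊢
    linarith
  calc volume K + volume L = volume ((sInf L +ᵥ K) ∪ (sSup K +ᵥ L)) := by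
        rw [measure_union₀ (hL.vadd (sSup K)).measurableSet.nullMeasurableSet hdisj,
          measure_vadd, measure_vadd]
    _ ≤ volume (K + L) := by
        refine measure_mono (union_subset ?_ ?_)
        · rintro _ ⟨x, hx, rfl⟩
          exact ⟨x, hx, sInf L, hL.sInf_mem hL0, add_comm _ _⟩
        · rintro _ ⟨y, hy, rfl⟩
          exact ⟨sSup K, hK.sSup_mem hK0, y, hy, rfl⟩

/-- The one-dimensional Brunn–Minkowski inequality. -/
theorem MeasurableSet.volume_add_volume_le_volume_add {A B : Set ℝ} (hA : MeasurableSet A)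
    (hB : MeasurableSet B) (hA0 : A.Nonempty) (hB0 : B.Nonempty) :
    volume A + volume B ≤ volume (A + B) := by
  obtain ⟨a, ha⟩ := hA0
  obtain ⟨b, hb⟩ := hB0
  rw [hA.measure_eq_iSup_isCompact, hB.measure_eq_iSup_isCompact]
  simp only [iSup_and']
  refine ENNReal.biSup_add_biSup_le' ⟨∅, by simp⟩ ⟨∅, by simp⟩ ?_
  rintro K ⟨hKA, hK⟩ L ⟨hLB, hL⟩
  calc volume K + volume L ≤ volume (insert a K) + volume (insert b L) := by
        gcongr <;> exact subset_insert _ _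
    _ ≤ volume (insert a K + insert b L) :=
        (hK.insert a).volume_add_volume_le_volume_add (hL.insert b) (insert_nonempty _ _)
          (insert_nonempty _ _)
    _ ≤ volume (A + B) := by
        gcongr
        exacts [insert_subset ha hKA, insert_subset hb hLB]

theorem ENNReal.rpow_mul_rpow_le_weighted_add {l : ℝ} (hl0 : 0 < l) (hl1 : l < 1) (a b : ℝ≥0∞) :
    a ^ l * b ^ (1 - l) ≤ ENNReal.ofReal l * a + ENNReal.ofReal (1 - l) * b := by
  have hl2 : 0 < 1 - l := sub_pos.2 hl1
  have hpq : (l⁻¹).HolderConjugate (1 - l)⁻¹ := by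
    rw [Real.holderConjugate_iff]
    exact ⟨(one_lt_inv₀ hl0).2 hl1, by simp⟩
  convert ENNReal.young_inequality (a ^ l) (b ^ (1 - l)) hpq using 2
  · rw [← ENNReal.rpow_mul, mul_inv_cancel₀ hl0.ne', ENNReal.rpow_one,
      ENNReal.ofReal_inv_of_pos hl0, div_eq_mul_inv, inv_inv, mul_comm]
  · rw [← ENNReal.rpow_mul, mul_inv_cancel₀ hl2.ne', ENNReal.rpow_one,
      ENNReal.ofReal_inv_of_pos hl2, div_eq_mul_inv, inv_inv, mul_comm]

/-- The Prékopa–Leindler inequality for functions of supremum one, in additive form. -/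
theorem lintegral_weighted_add_le_of_isLUB_one {u v w : ℝ → ℝ} {l : ℝ} (hl0 : 0 < l) (hl1 : l < 1)
    (hu : Measurable u) (hv : Measurable v) (hw : Measurable w)
    (hu0 : ∀ x, 0 ≤ u x) (hv0 : ∀ x, 0 ≤ v x) (hw0 : ∀ x, 0 ≤ w x)
    (hu1 : IsLUB (range u) 1) (hv1 : IsLUB (range v) 1)
    (h : ∀ x y, u x ^ l * v y ^ (1 - l) ≤ w (l * x + (1 - l) * y)) :
    ENNReal.ofReal l * (∫⁻ x, ENNReal.ofReal (u x)) + ENNReal.ofReal (1 - l) *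
      (∫⁻ x, ENNReal.ofReal (v x)) ≤ ∫⁻ x, ENNReal.ofReal (w x) := by
  have hl2 : 0 < 1 - l := sub_pos.2 hl1
  rw [lintegral_eq_lintegral_meas_lt _ (.of_forall hu0) hu.aemeasurable,
    lintegral_eq_lintegral_meas_lt _ (.of_forall hv0) hv.aemeasurable,
    lintegral_eq_lintegral_meas_lt _ (.of_forall hw0) hw.aemeasurable,
    ← lintegral_const_mul' _ _ ENNReal.ofReal_ne_top,
    ← lintegral_const_mul' _ _ ENNReal.ofReal_ne_top, ← lintegral_add_left]
  swap
  · exact Measurable.const_mul (Antitone.measurable fun s t (hst : s ≤ t) =>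
      measure_mono fun x (hx : t < u x) => hst.trans_lt hx) _
  refine setLIntegral_mono' measurableSet_Ioi fun t (ht : 0 < t) => ?_
  rcases lt_or_ge t 1 with ht1 | ht1
  · obtain ⟨_, ⟨x, rfl⟩, hx, -⟩ := hu1.exists_between ht1
    obtain ⟨_, ⟨y, rfl⟩, hy, -⟩ := hv1.exists_between ht1
    have hA := (measurableSet_lt (measurable_const (a := t)) hu).const_smul₀ l
    have hB := (measurableSet_lt (measurable_const (a := t)) hv).const_smul₀ (1 - l)
    have := hA.volume_add_volume_le_volume_add hB (Set.Nonempty.smul_set ⟨x, hx⟩)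
      (Set.Nonempty.smul_set ⟨y, hy⟩)
    simp only [Measure.addHaar_smul, Module.finrank_self, pow_one, abs_of_pos hl0,
      abs_of_pos hl2] at this
    refine this.trans (measure_mono ?_)
    rintro _ ⟨_, ⟨x, hx, rfl⟩, _, ⟨y, hy, rfl⟩, rfl⟩
    refine lt_of_lt_of_le ?_ (h x y)
    calc t = t ^ l * t ^ (1 - l) := by rw [← Real.rpow_add ht]; simp
      _ < u x ^ l * v y ^ (1 - l) :=
        mul_lt_mul_of_pos' (Real.rpow_lt_rpow ht.le hx hl0) (Real.rpow_lt_rpow ht.le hy hl2)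
          (by positivity) (Real.rpow_pos_of_pos (ht.trans hx) _)
  · have hA : {x | t < u x} = ∅ :=
      eq_empty_of_forall_notMem fun x hx => (hx.trans_le (hu1.1 ⟨x, rfl⟩)).not_ge ht1
    have hB : {x | t < v x} = ∅ :=
      eq_empty_of_forall_notMem fun x hx => (hx.trans_le (hv1.1 ⟨x, rfl⟩)).not_ge ht1
    simp [hA, hB]

/-- The one-dimensional Prékopa–Leindler inequality for bounded functions. -/
theorem prekopa_leindler {u v w : ℝ → ℝ} {l : ℝ} (hl0 : 0 < l) (hl1 : l < 1)
    (hu : Measurable u) (hv : Measurable v) (hw : Measurable w)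
    (hu0 : ∀ x, 0 ≤ u x) (hv0 : ∀ x, 0 ≤ v x) (hw0 : ∀ x, 0 ≤ w x)
    (hub : BddAbove (range u)) (hvb : BddAbove (range v))
    (h : ∀ x y, u x ^ l * v y ^ (1 - l) ≤ w (l * x + (1 - l) * y)) :
    (∫⁻ x, ENNReal.ofReal (u x)) ^ l * (∫⁻ x, ENNReal.ofReal (v x)) ^ (1 - l) ≤
      ∫⁻ x, ENNReal.ofReal (w x) := by
  have hl2 : 0 < 1 - l := sub_pos.2 hl1
  obtain ⟨M, hM⟩ := Real.exists_isLUB (range_nonempty u) hub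
  obtain ⟨N, hN⟩ := Real.exists_isLUB (range_nonempty v) hvb
  have hM0 : 0 ≤ M := (hu0 0).trans (hM.1 ⟨0, rfl⟩)
  have hN0 : 0 ≤ N := (hv0 0).trans (hN.1 ⟨0, rfl⟩)
  rcases hM0.eq_or_lt with rfl | hM0
  · have : ∀ x, u x = 0 := fun x => le_antisymm (hM.1 ⟨x, rfl⟩) (hu0 x)
    simp [this, hl0]
  rcases hN0.eq_or_lt with rfl | hN0
  · have : ∀ x, v x = 0 := fun x => le_antisymm (hN.1 ⟨x, rfl⟩) (hv0 x)
    simp [this, hl1]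
  have hlub {p : ℝ → ℝ} {S : ℝ} (hS : 0 < S) (hp : IsLUB (range p) S) :
      IsLUB (range fun x => S⁻¹ * p x) 1 := by
    have := hp.mul_left (inv_pos.2 hS).le
    rwa [inv_mul_cancel₀ hS.ne', ← range_comp] at this
  have hMl : 0 < M ^ l := Real.rpow_pos_of_pos hM0 _
  have hNl : 0 < N ^ (1 - l) := Real.rpow_pos_of_pos hN0 _
  have key := lintegral_weighted_add_le_of_isLUB_one (u := fun x => M⁻¹ * u x)
    (v := fun x => N⁻¹ * v x) (w := fun x => (M ^ l * N ^ (1 - l))⁻¹ * w x) hl0 hl1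
    (hu.const_mul _) (hv.const_mul _) (hw.const_mul _)
    (fun x => mul_nonneg (by positivity) (hu0 x)) (fun x => mul_nonneg (by positivity) (hv0 x))
    (fun x => mul_nonneg (by positivity) (hw0 x)) (hlub hM0 hM) (hlub hN0 hN) (by
      intro x y
      rw [Real.mul_rpow (by positivity) (hu0 x), Real.mul_rpow (by positivity) (hv0 y),
        Real.inv_rpow hM0.le, Real.inv_rpow hN0.le, mul_mul_mul_comm, ← mul_inv]
      exact mul_le_mul_of_nonneg_left (h x y) (by positivity))
  have hscale (S : ℝ) (hS : 0 < S) (p : ℝ → ℝ) : ∫⁻ x, ENNReal.ofReal (S⁻¹ * p x) =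
      (ENNReal.ofReal S)⁻¹ * ∫⁻ x, ENNReal.ofReal (p x) := by
    simp_rw [ENNReal.ofReal_mul (inv_pos.2 hS).le, ENNReal.ofReal_inv_of_pos hS]
    rw [lintegral_const_mul' _ _ (by simpa using hS)]
  have := (ENNReal.rpow_mul_rpow_le_weighted_add hl0 hl1 _ _).trans key
  rw [hscale M hM0, hscale N hN0, hscale _ (mul_pos hMl hNl),
    ENNReal.mul_rpow_of_nonneg _ _ hl0.le, ENNReal.mul_rpow_of_nonneg _ _ hl2.le,
    mul_mul_mul_comm, ENNReal.inv_rpow, ENNReal.inv_rpow, ENNReal.ofReal_rpow_of_pos hM0,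
    ENNReal.ofReal_rpow_of_pos hN0, ENNReal.ofReal_mul hMl.le,
    ← ENNReal.mul_inv (.inr (by simp)) (.inl (by simp))] at this
  refine (ENNReal.mul_le_mul_iff_right ?_ ?_).1 this
  · simp [ENNReal.mul_eq_top]
  · simp [hMl, hNl]

theorem IsLogConcave.measurable {f : ℝ → ℝ} (hf0 : ∀ x, 0 ≤ f x) (hf : IsLogConcave f) :
    Measurable f := by
  refine measurable_of_Ici fun c => ?_
  rcases le_or_gt c 0 with hc | hc
  · convert MeasurableSet.univ
    exact eq_univ_of_forall fun x => hc.trans (hf0 x)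
  refine (Convex.ordConnected fun x hx y hy a b ha hb hab => ?_).measurableSet
  obtain rfl : b = 1 - a := by linarith
  refine le_trans ?_ (hf x y a ha (by linarith))
  calc c = c ^ a * c ^ (1 - a) := by rw [← Real.rpow_add hc]; simp
    _ ≤ f x ^ a * f y ^ (1 - a) :=
      mul_le_mul (Real.rpow_le_rpow hc.le hx ha) (Real.rpow_le_rpow hc.le hy hb)
        (by positivity) (Real.rpow_nonneg (hf0 x) _)

theorem IsLogConcave.bddAbove_range {f : ℝ → ℝ} (hf0 : ∀ x, 0 ≤ f x) (hf : IsLogConcave f)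
    (hfin : ∫⁻ x, ENNReal.ofReal (f x) ≠ ∞) (hpos : ∫⁻ x, ENNReal.ofReal (f x) ≠ 0) :
    BddAbove (range f) := by
  have hm := hf.measurable hf0
  have markov (s : ℝ) : ENNReal.ofReal s * volume {z | s ≤ f z} ≤ ∫⁻ x, ENNReal.ofReal (f x) := by
    refine le_trans ?_ (mul_meas_ge_le_lintegral hm.ennreal_ofReal (ENNReal.ofReal s))
    gcongr with z
    exact fun hz => ENNReal.ofReal_le_ofReal hz
  set I := ∫⁻ x, ENNReal.ofReal (f x) with hI
  obtain ⟨c, hc, hE⟩ : ∃ c : ℝ, 0 < c ∧ volume {y | c ≤ f y} ≠ 0 := by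
    by_contra! h
    refine hpos ?_
    rw [hI, lintegral_eq_lintegral_meas_le _ (.of_forall hf0) hm.aemeasurable]
    exact (setLIntegral_congr_fun measurableSet_Ioi h).trans (by simp)
  set E := {y | c ≤ f y}
  have hEtop : volume E ≠ ∞ := by
    intro h
    have := markov c
    rw [show {z | c ≤ f z} = E from rfl, h, ENNReal.mul_top (by simpa using hc)] at this
    exact hfin (top_le_iff.1 this)
  have hE' : 0 < (volume E).toReal := ENNReal.toReal_pos hE hEtop
  refine ⟨(I.toReal / (2⁻¹ * (volume E).toReal)) ^ 2 / c, ?_⟩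
  rintro _ ⟨x, rfl⟩
  have hsub : (2⁻¹ * x) +ᵥ ((2⁻¹ : ℝ) • E) ⊆ {z | √(f x * c) ≤ f z} := by
    rintro _ ⟨_, ⟨y, hy, rfl⟩, rfl⟩
    have := hf x y 2⁻¹ (by norm_num) (by norm_num)
    rw [show (1 - 2⁻¹ : ℝ) = 2⁻¹ by norm_num] at this
    refine le_trans ?_ this
    rw [Real.sqrt_mul (hf0 x), Real.sqrt_eq_rpow, Real.sqrt_eq_rpow, one_div]
    exact mul_le_mul_of_nonneg_left (Real.rpow_le_rpow hc.le hy (by norm_num))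
      (Real.rpow_nonneg (hf0 x) _)
  have h1 : ENNReal.ofReal (√(f x * c)) * (ENNReal.ofReal 2⁻¹ * volume E) ≤ I := by
    refine le_trans ?_ (markov (√(f x * c)))
    gcongr
    refine le_trans ?_ (measure_mono hsub)
    rw [measure_vadd, Measure.addHaar_smul]
    simp
  have h2 := ENNReal.toReal_mono hfin h1
  rw [ENNReal.toReal_mul, ENNReal.toReal_mul, ENNReal.toReal_ofReal (Real.sqrt_nonneg _),
    ENNReal.toReal_ofReal (by norm_num)] at h2
  rw [le_div_iff₀ hc]
  exact Real.sqrt_le_left (by positivity) |>.1 ((le_div_iff₀ (by positivity)).2 h2)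

theorem IsLogConcave.autocorrelation {f : ℝ → ℝ} (hf0 : ∀ x, 0 ≤ f x) (hf : IsLogConcave f)
    (hb : BddAbove (range f))
    (hfin : ∀ z, ∫⁻ y, ENNReal.ofReal (f (z + y) * f y) ≠ ∞) :
    IsLogConcave fun z => (∫⁻ y, ENNReal.ofReal (f (z + y) * f y)).toReal := by
  have hm := hf.measurable hf0
  have hprod0 (z y : ℝ) : 0 ≤ f (z + y) * f y := mul_nonneg (hf0 _) (hf0 _)
  have hprodm (z : ℝ) : Measurable fun y => f (z + y) * f y := by fun_prop
  have hprodb (z : ℝ) : BddAbove (range fun y => f (z + y) * f y) := by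
    obtain ⟨C, hC⟩ := hb
    refine ⟨C * C, ?_⟩
    rintro _ ⟨y, rfl⟩
    exact mul_le_mul (hC ⟨_, rfl⟩) (hC ⟨_, rfl⟩) (hf0 _) ((hf0 0).trans (hC ⟨_, rfl⟩))
  intro x x' l hl0 hl1
  simp only [Real.rpow_eq_pow]
  rcases hl0.eq_or_lt with rfl | hl0
  · simp
  rcases hl1.eq_or_lt with rfl | hl1
  · simp
  rw [ENNReal.toReal_rpow, ENNReal.toReal_rpow, ← ENNReal.toReal_mul]
  refine ENNReal.toReal_mono (hfin _) (prekopa_leindler hl0 hl1 (hprodm x) (hprodm x')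
    (hprodm _) (hprod0 x) (hprod0 x') (hprod0 _) (hprodb x) (hprodb x') fun a b => ?_)
  rw [Real.mul_rpow (hf0 _) (hf0 _), Real.mul_rpow (hf0 _) (hf0 _), mul_mul_mul_comm]
  refine mul_le_mul ?_ (hf a b l hl0.le hl1.le)
    (mul_nonneg (Real.rpow_nonneg (hf0 _) _) (Real.rpow_nonneg (hf0 _) _)) (hf0 _)
  refine (hf (x + a) (x' + b) l hl0.le hl1.le).trans_eq (congrArg f ?_)
  ring

theorem map_sub_prod_withDensity {F G : ℝ → ℝ≥0∞} (hF : Measurable F) (hG : Measurable G) :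
    (((volume : Measure ℝ).withDensity F).prod (volume.withDensity G)).map (fun p => p.1 - p.2) =
      volume.withDensity fun z => ∫⁻ y, F (z + y) * G y := by
  refine Measure.ext_of_lintegral _ fun φ hφ => ?_
  have hm : Measurable fun z => ∫⁻ y, F (z + y) * G y :=
    Measurable.lintegral_prod_right' (f := fun p : ℝ × ℝ => F (p.1 + p.2) * G p.2) (by fun_prop)
  rw [lintegral_map hφ (by fun_prop), prod_withDensity hF hG,
    lintegral_withDensity_eq_lintegral_mul _ (by fun_prop) (by fun_prop),
    lintegral_withDensity_eq_lintegral_mul _ hm hφ, lintegral_prod_symm _ (by fun_prop)]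
  simp only [Pi.mul_apply]
  calc ∫⁻ y, ∫⁻ x, F x * G y * φ (x - y)
      = ∫⁻ y, ∫⁻ z, F (z + y) * G y * φ z := by
        refine lintegral_congr fun y => ?_
        rw [← lintegral_add_right_eq_self _ y]
        simp
    _ = ∫⁻ z, ∫⁻ y, F (z + y) * G y * φ z := lintegral_lintegral_swap (by fun_prop)
    _ = ∫⁻ z, (∫⁻ y, F (z + y) * G y) * φ z :=
        lintegral_congr fun z => lintegral_mul_const _ (by fun_prop)

theorem nullMeasurableSet_of_measure_add_measure_compl_le {Ω : Type*} [MeasurableSpace Ω]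
    {P : Measure Ω} [IsFiniteMeasure P] {A : Set Ω} (h : P A + P Aᶜ ≤ P univ) :
    NullMeasurableSet A P := by
  set T := toMeasurable P A
  set U := toMeasurable P Aᶜ
  have hTU : T ∪ U = univ := eq_univ_of_forall fun x =>
    (em (x ∈ A)).imp (fun hx => subset_toMeasurable P A hx) fun hx => subset_toMeasurable P Aᶜ hx
  have hinter : P (T ∩ U) = 0 := by
    have h1 := measure_union_add_inter (μ := P) T (measurableSet_toMeasurable P Aᶜ)
    rw [measure_toMeasurable, measure_toMeasurable] at h1
    change P (T ∪ U) + P (T ∩ U) = _ at h1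
    rw [hTU] at h1
    exact le_zero_iff.1 <| (ENNReal.add_le_add_iff_left (measure_ne_top P univ)).1
      (by rw [h1, add_zero]; exact h)
  refine (measurableSet_toMeasurable P A).nullMeasurableSet.congr ?_
  refine Filter.EventuallyLE.antisymm (ae_le_set.2 ?_)
    (Filter.Eventually.of_forall (subset_toMeasurable P A))
  exact measure_mono_null (inter_subset_inter_right T (subset_toMeasurable P Aᶜ)) hinter

/-- Independent summands of an a.e.-measurable difference are a.e.-measurable, even though
independence alone says nothing about measurability. -/
theorem ProbabilityTheory.IndepFun.aemeasurable_left_of_sub {Ω : Type*} [MeasurableSpace Ω]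
    {P : Measure Ω} [IsProbabilityMeasure P] {X Y : Ω → ℝ} (hind : IndepFun X Y P)
    (hsub : AEMeasurable (fun ω => X ω - Y ω) P) : AEMeasurable X P := by
  have hgap (a d : ℝ) (hd : 0 < d) : P (X ⁻¹' Ici a) + P (X ⁻¹' Iic (a - d)) ≤ 1 := by
    obtain ⟨k, hk⟩ : ∃ k : ℤ, P (Y ⁻¹' Ico (k • d) ((k + 1) • d)) ≠ 0 := by
      by_contra! h
      have : P (Y ⁻¹' univ) = 0 := by
        rw [← iUnion_Ico_zsmul hd, preimage_iUnion]
        exact measure_iUnion_null h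
      simp at this
    set b := k • d
    have hb : (k + 1) • d = b + d := by simp [b, add_smul]
    rw [hb] at hk
    set B := Ico b (b + d)
    set S := (fun ω => X ω - Y ω) ⁻¹' Ioi (a - d - b)
    have hS : NullMeasurableSet S P := hsub.nullMeasurable measurableSet_Ioi
    have hmul (s : Set ℝ) (hs : MeasurableSet s) :
        P (X ⁻¹' s ∩ Y ⁻¹' B) = P (X ⁻¹' s) * P (Y ⁻¹' B) :=
      hind.measure_inter_preimage_eq_mul _ _ hs measurableSet_Ico
    have h1 : (P (X ⁻¹' Ici a) + P (X ⁻¹' Iic (a - d))) * P (Y ⁻¹' B) ≤ 1 * P (Y ⁻¹' B) := by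
      rw [add_mul, ← hmul _ measurableSet_Ici, ← hmul _ measurableSet_Iic, one_mul,
        ← measure_inter_add_sdiff₀ (Y ⁻¹' B) hS]
      refine add_le_add (measure_mono ?_) (measure_mono ?_)
      · rintro ω ⟨h1, h2, h3⟩
        refine ⟨⟨h2, h3⟩, ?_⟩
        simp only [S, mem_preimage, mem_Ioi, mem_Ici] at h1 ⊢
        linarith
      · rintro ω ⟨h1, h2, h3⟩
        refine ⟨⟨h2, h3⟩, ?_⟩
        simp only [S, mem_preimage, mem_Ioi, mem_Iic, not_lt] at h1 ⊢
        linarith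
    exact (ENNReal.mul_le_mul_iff_left hk (measure_ne_top _ _)).1 h1
  have hnull (a : ℝ) : NullMeasurableSet (X ⁻¹' Ici a) P := by
    refine nullMeasurableSet_of_measure_add_measure_compl_le ?_
    have hU : (X ⁻¹' Ici a)ᶜ = ⋃ n : ℕ, X ⁻¹' Iic (a - 1 / ((n : ℝ) + 1)) := by
      ext ω
      simp only [mem_compl_iff, mem_preimage, mem_Ici, not_le, mem_iUnion, mem_Iic]
      constructor
      · intro h
        obtain ⟨n, hn⟩ := exists_nat_one_div_lt (sub_pos.2 h)
        exact ⟨n, by linarith⟩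
      · rintro ⟨n, hn⟩
        have : 0 < 1 / ((n : ℝ) + 1) := by positivity
        linarith
    rw [hU, Monotone.measure_iUnion, ENNReal.add_iSup, measure_univ]
    · exact iSup_le fun n => hgap a _ (by positivity)
    · intro m n hmn
      refine preimage_mono (Iic_subset_Iic.2 ?_)
      have := one_div_le_one_div_of_le (by positivity : (0 : ℝ) < (m : ℝ) + 1)
        (by exact_mod_cast Nat.succ_le_succ hmn : (m : ℝ) + 1 ≤ (n : ℝ) + 1)
      linarith
  have hX : NullMeasurable X P := fun s hs =>
    (measurable_of_Ici (δ := NullMeasurableSpace Ω P) (f := X) hnull) hs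
  exact hX.aemeasurable

theorem sub_of_logConcave_density {Ω : Type*} [MeasurableSpace Ω]
    (P : Measure Ω) [IsProbabilityMeasure P] (X X' : Ω → ℝ) (f : ℝ → ℝ)
    (hf0 : ∀ x, 0 ≤ f x) (hlc : IsLogConcave f)
    (hX : Measure.map X P = volume.withDensity fun x => ENNReal.ofReal (f x))
    (hX' : Measure.map X' P = volume.withDensity fun x => ENNReal.ofReal (f x))
    (hind : IndepFun X X' P) :
    ∃ g : ℝ → ℝ, (∀ x, 0 ≤ g x) ∧ IsLogConcave g ∧
      Measure.map (fun ω => X ω - X' ω) P =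
        volume.withDensity fun x => ENNReal.ofReal (g x) := by
  by_cases hsub : AEMeasurable (fun ω => X ω - X' ω) P
  swap
  · refine ⟨0, fun _ => le_rfl, fun x y l hl0 hl1 => ?_, ?_⟩
    · rcases hl0.eq_or_lt with rfl | hl0 <;> simp [*, ne_of_gt]
    · simp [Measure.map_of_not_aemeasurable hsub]
  have hmX : AEMeasurable X P := hind.aemeasurable_left_of_sub hsub
  have hmX' : AEMeasurable X' P := by
    by_contra h
    have h0 := hX.trans (hX'.symm.trans (Measure.map_of_not_aemeasurable h))
    exact IsProbabilityMeasure.ne_zero P ((Measure.map_eq_zero_iff hmX).1 h0)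
  have hm := hlc.measurable hf0
  have hone : ∫⁻ x, ENNReal.ofReal (f x) = 1 := by
    have := (Measure.isProbabilityMeasure_map hmX).measure_univ
    rwa [hX, withDensity_apply _ MeasurableSet.univ, setLIntegral_univ] at this
  have hb := hlc.bddAbove_range hf0 (by simp [hone]) (by simp [hone])
  have hfin (z : ℝ) : ∫⁻ y, ENNReal.ofReal (f (z + y) * f y) ≠ ∞ := by
    obtain ⟨C, hC⟩ := hb
    refine ne_top_of_le_ne_top (b := ∫⁻ y, ENNReal.ofReal C * ENNReal.ofReal (f y)) ?_ ?_
    · rw [lintegral_const_mul' _ _ ENNReal.ofReal_ne_top, hone]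
      simp
    · refine lintegral_mono fun y => ?_
      rw [ENNReal.ofReal_mul (hf0 _)]
      gcongr
      exact hC ⟨_, rfl⟩
  refine ⟨fun z => (∫⁻ y, ENNReal.ofReal (f (z + y) * f y)).toReal,
    fun _ => ENNReal.toReal_nonneg, hlc.autocorrelation hf0 hb hfin, ?_⟩
  have hlaw := (indepFun_iff_map_prod_eq_prod_map_map hmX hmX').1 hind
  rw [hX, hX'] at hlaw
  simp_rw [ENNReal.ofReal_toReal (hfin _), ENNReal.ofReal_mul (hf0 _)]
  rw [← map_sub_prod_withDensity hm.ennreal_ofReal hm.ennreal_ofReal, ← hlaw,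
    AEMeasurable.map_map_of_aemeasurable (by fun_prop) (hmX.prodMk hmX')]
  rfl
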